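/- arXiv:1705.00134 — 3 statements merged into one kernel-verified Lean document; each statement's English description precedes it below -/
import Mathlib

section
/- Let d ≥ 1, let P be a finite partially ordered set on [d] = {1,...,d}, and let G be a perfect graph on [d]. Then the Ehrhart δ-polynomials satisfy δ(Ω(O_P, Q_G), λ) = (1+λ) · δ(Γ(O_P, Q_G), λ). -/
open scoped Pointwise

namespace HibiTsuchiya

/-- A point of `ℝ^n` is a *lattice point* if all of its coordinates are integers. -/
def IsLatticePoint {n : ℕ} (x : Fin n → ℝ) : Prop := ∀ i, ∃ z : ℤ, x i = (z : ℝ)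

/-- The dual polytope `P^∨ = {x : ⟨x,y⟩ ≤ 1 for all y ∈ P}`. -/
def dualPolytope {n : ℕ} (P : Set (Fin n → ℝ)) : Set (Fin n → ℝ) :=
  {x | ∀ y ∈ P, ∑ i, x i * y i ≤ 1}

/-- A polytope `P ⊆ ℝ^n` is *reflexive* if the origin is an interior point of `P` and the
dual polytope of `P` is again a lattice polytope (i.e. the convex hull of finitely many
lattice points). -/
def IsReflexive {n : ℕ} (P : Set (Fin n → ℝ)) : Prop :=
  0 ∈ interior P ∧
    ∃ V : Finset (Fin n → ℝ), (∀ v ∈ V, IsLatticePoint v) ∧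
      dualPolytope P = convexHull ℝ (V : Set (Fin n → ℝ))

/-- `P` has the *integer decomposition property* if every lattice point of `m • P` (`m ≥ 1`)
is a sum of `m` lattice points of `P`. -/
def HasIDP {n : ℕ} (P : Set (Fin n → ℝ)) : Prop :=
  ∀ m : ℕ, 0 < m → ∀ a : Fin n → ℝ, IsLatticePoint a → a ∈ (m : ℝ) • P →
    ∃ f : Fin m → Fin n → ℝ, (∀ k, f k ∈ P ∧ IsLatticePoint (f k)) ∧ a = ∑ k, f k

/-- The indicator vector `ρ(S) = ∑_{j ∈ S} e_j` of a subset `S ⊆ [n]`. -/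
noncomputable def indicator {n : ℕ} (S : Set (Fin n)) : Fin n → ℝ :=
  S.indicator (fun _ => (1 : ℝ))

/-- A poset ideal of a partial order `P` on `[n]`. -/
def IsPosetIdeal {n : ℕ} (P : PartialOrder (Fin n)) (I : Set (Fin n)) : Prop :=
  ∀ i ∈ I, ∀ j, P.le j i → j ∈ I

/-- The order polytope `O_P`: the convex hull of the indicator vectors of poset ideals. -/
noncomputable def orderPolytope {n : ℕ} (P : PartialOrder (Fin n)) : Set (Fin n → ℝ) :=
  convexHull ℝ {x | ∃ I : Set (Fin n), IsPosetIdeal P I ∧ x = indicator I}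

/-- An antichain of a partial order `P` on `[n]`: a pairwise incomparable subset. -/
def IsPosetAntichain {n : ℕ} (P : PartialOrder (Fin n)) (A : Set (Fin n)) : Prop :=
  ∀ i ∈ A, ∀ j ∈ A, i ≠ j → ¬ P.le i j ∧ ¬ P.le j i

/-- The chain polytope `C_P`: the convex hull of the indicator vectors of antichains. -/
noncomputable def chainPolytope {n : ℕ} (P : PartialOrder (Fin n)) : Set (Fin n → ℝ) :=
  convexHull ℝ {x | ∃ A : Set (Fin n), IsPosetAntichain P A ∧ x = indicator A}

/-- A stable (independent) set of a graph. -/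
def IsStableSet {V : Type*} (G : SimpleGraph V) (S : Set V) : Prop :=
  ∀ i ∈ S, ∀ j ∈ S, ¬ G.Adj i j

/-- The stable set polytope `Q_G`: the convex hull of the indicator vectors of stable sets. -/
noncomputable def stableSetPolytope {n : ℕ} (G : SimpleGraph (Fin n)) : Set (Fin n → ℝ) :=
  convexHull ℝ {x | ∃ S : Set (Fin n), IsStableSet G S ∧ x = indicator S}

/-- The clique number of a graph, as an extended natural number. -/
noncomputable def cliqueNumber {V : Type*} (G : SimpleGraph V) : ℕ∞ :=
  ⨆ (t : Finset V) (_ : G.IsClique (t : Set V)), (t.card : ℕ∞)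

/-- A graph is *perfect* if for every induced subgraph (including the graph itself)
the chromatic number equals the clique number. -/
def IsPerfectGraph {V : Type*} (G : SimpleGraph V) : Prop :=
  ∀ s : Set V, (G.induce s).chromaticNumber = cliqueNumber (G.induce s)

/-- A simplicial complex on the vertex set `[n]`. -/
def IsSimplicialComplex {n : ℕ} (Δ : Set (Finset (Fin n))) : Prop :=
  (∀ i : Fin n, {i} ∈ Δ) ∧ ∀ F ∈ Δ, ∀ F' ⊆ F, F' ∈ Δ

/-- The polytope `P_Δ`: the convex hull of the indicator vectors of the faces of `Δ`. -/
noncomputable def complexPolytope {n : ℕ} (Δ : Set (Finset (Fin n))) : Set (Fin n → ℝ) :=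
  convexHull ℝ {x | ∃ F ∈ Δ, x = indicator (↑F : Set (Fin n))}

/-- `Γ(P,Q) = conv(P ∪ (−Q))`. -/
noncomputable def gammaPolytope {n : ℕ} (P Q : Set (Fin n → ℝ)) : Set (Fin n → ℝ) :=
  convexHull ℝ (P ∪ -Q)

/-- `Ω(P,Q) = conv((P × {1}) ∪ ((−Q) × {−1})) ⊆ ℝ^{n+1}`. -/
noncomputable def omegaPolytope {n : ℕ} (P Q : Set (Fin n → ℝ)) : Set (Fin (n+1) → ℝ) :=
  convexHull ℝ
    ((fun x : Fin n → ℝ => Fin.snoc x (1 : ℝ)) '' P ∪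
     (fun x : Fin n → ℝ => Fin.snoc x (-1 : ℝ)) '' (-Q))

/-- The number of lattice points of a set `P ⊆ ℝ^n`. -/
noncomputable def latticePointCount {n : ℕ} (P : Set (Fin n → ℝ)) : ℕ :=
  Set.ncard {x | x ∈ P ∧ IsLatticePoint x}

/-- The Ehrhart series `1 + ∑_{m ≥ 1} |mP ∩ ℤ^n| λ^m` of `P ⊆ ℝ^n`. -/
noncomputable def ehrhartSeries {n : ℕ} (P : Set (Fin n → ℝ)) : PowerSeries ℚ :=
  PowerSeries.mk fun m => if m = 0 then 1 else (latticePointCount ((m : ℝ) • P) : ℚ)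

/-- The Ehrhart `δ`-polynomial `δ(P,λ) = (1-λ)^{n+1} (1 + ∑_{m ≥ 1} |mP ∩ ℤ^n| λ^m)`
of a polytope `P ⊆ ℝ^n`, encoded as a formal power series. -/
noncomputable def deltaPolynomial {n : ℕ} (P : Set (Fin n → ℝ)) : PowerSeries ℚ :=
  (1 - PowerSeries.X) ^ (n + 1) * ehrhartSeries P

/-! ### Helper lemmas -/

open Classical in
/-- Weighted colouring of perfect graphs (Lovász replication). -/
lemma weighted_coloring {d : ℕ} (G : SimpleGraph (Fin d)) (hG : IsPerfectGraph G) :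
    ∀ (N : ℕ) (w : Fin d → ℕ) (r : ℕ), ∑ i, w i ≤ N →
      (∀ t : Finset (Fin d), G.IsClique (t : Set (Fin d)) → ∑ i ∈ t, w i ≤ r) →
      ∃ f : Fin r → Set (Fin d), (∀ k, IsStableSet G (f k)) ∧
        ∀ i, w i = ∑ k, if i ∈ f k then 1 else 0 := by
  have base : ∀ (w : Fin d → ℕ) (r : ℕ), (∀ i, w i ≤ 1) →
      (∀ t : Finset (Fin d), G.IsClique (t : Set (Fin d)) → ∑ i ∈ t, w i ≤ r) →
      ∃ f : Fin r → Set (Fin d), (∀ k, IsStableSet G (f k)) ∧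
        ∀ i, w i = ∑ k, if i ∈ f k then 1 else 0 := by
    intro w r hw hc
    set s : Set (Fin d) := {i | w i = 1} with hs
    have h1 : (G.induce s).chromaticNumber ≤ r := by
      rw [hG s]
      refine iSup₂_le fun t ht => ?_
      have := hc (t.map (Function.Embedding.subtype _)) (by
        intro a ha b hb hab
        simp only [Finset.coe_map, Set.mem_image, Function.Embedding.subtype_apply] at ha hb
        obtain ⟨a', ha', rfl⟩ := ha
        obtain ⟨b', hb', rfl⟩ := hb
        have := ht ha' hb' (by rintro rfl; exact hab rfl)
        simpa using this)
      rw [Finset.sum_map] at this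
      have h2 : ∑ x ∈ t, w ((Function.Embedding.subtype fun i => i ∈ s) x) = t.card := by
        rw [Finset.card_eq_sum_ones]
        exact Finset.sum_congr rfl fun x _ => x.2
      rw [h2] at this
      exact_mod_cast this
    rw [SimpleGraph.chromaticNumber_le_iff_colorable] at h1
    obtain ⟨C⟩ := h1
    refine ⟨fun k => {i | ∃ h : i ∈ s, C ⟨i, h⟩ = k}, ?_, ?_⟩
    · rintro k i ⟨hi, hik⟩ j ⟨hj, hjk⟩ hij
      have : (G.induce s).Adj ⟨i, hi⟩ ⟨j, hj⟩ := by simpa using hij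
      exact C.valid this (hik.trans hjk.symm)
    · intro i
      by_cases hi : i ∈ s
      · have : ∀ k, (i ∈ {i | ∃ h : i ∈ s, C ⟨i, h⟩ = k}) ↔ C ⟨i, hi⟩ = k := by
          intro k; simp [hi]
        simp only [this, Finset.sum_ite_eq, Finset.mem_univ, if_true]
        exact hi
      · have h0 : w i = 0 := by
          have := hw i
          have h3 : w i ≠ 1 := hi
          omega
        simp [hi, h0]
  intro N
  induction N with
  | zero =>
    intro w r hN hc
    refine base w r ?_ hc
    intro i
    have := Finset.single_le_sum (f := w) (fun i _ => Nat.zero_le _) (Finset.mem_univ i)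
    omega
  | succ N ih =>
    intro w r hN hc
    by_cases hw : ∀ i, w i ≤ 1
    · exact base w r hw hc
    push Not at hw
    obtain ⟨x, hx⟩ := hw
    set w' : Fin d → ℕ := fun i => w i - if i = x then 1 else 0 with hw'
    have hadd : ∀ i, w i = w' i + if i = x then 1 else 0 := by
      intro i
      by_cases h : i = x
      · subst h; simp [hw']; omega
      · simp [hw', h]
    have hsum : ∀ t : Finset (Fin d), ∑ i ∈ t, w i = ∑ i ∈ t, w' i + if x ∈ t then 1 else 0 := by
      intro t
      rw [Finset.sum_congr rfl fun i _ => hadd i, Finset.sum_add_distrib]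
      simp
    have hw'N : ∑ i, w' i ≤ N := by
      have := hsum Finset.univ
      simp at this
      omega
    obtain ⟨S, hS, hSw⟩ := ih w' r hw'N (fun t ht => by
      have := hsum t
      have := hc t ht
      omega)
    have hex : ∃ k, x ∈ S k := by
      by_contra hcon
      push Not at hcon
      have h1 := hSw x
      simp [hcon] at h1
      have := hadd x
      simp at this
      omega
    obtain ⟨k0, hk0⟩ := hex
    obtain ⟨q, rfl⟩ : ∃ q, r = q + 1 := by
      have := hc {x} (by simp)
      simp at this
      exact ⟨r - 1, by omega⟩
    set w'' : Fin d → ℕ := fun i => w i - if i ∈ S k0 then 1 else 0 with hw''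
    have hle : ∀ i, (if i ∈ S k0 then 1 else 0) ≤ w' i := by
      intro i
      rw [hSw i]
      exact Finset.single_le_sum (f := fun k => if i ∈ S k then 1 else 0)
        (fun i _ => Nat.zero_le _) (Finset.mem_univ k0)
    have hw''add : ∀ i, w i = (if i ∈ S k0 then 1 else 0) + w'' i := by
      intro i
      have := hle i
      have := hadd i
      simp only [hw'']
      omega
    have hw''le : ∀ i, w'' i ≤ w' i := by
      intro i
      have h1 := hadd i
      have h2 := hw''add i
      by_cases h : i = x
      · subst h; simp [hk0] at h1 h2; omega
      · simp [h] at h1; omega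
    have hstab : ∀ (t : Finset (Fin d)), G.IsClique (t : Set (Fin d)) → ∀ k,
        (∑ i ∈ t, if i ∈ S k then 1 else 0) ≤ 1 := by
      intro t ht k
      rw [← Finset.card_filter, Finset.card_le_one]
      intro a ha b hb
      simp only [Finset.mem_filter] at ha hb
      by_contra hab
      exact hS k a ha.2 b hb.2 (ht ha.1 hb.1 hab)
    obtain ⟨T, hT, hTw⟩ := ih w'' q
      ((Finset.sum_le_sum fun i _ => hw''le i).trans hw'N) (by
        intro t ht
        by_cases hxt : x ∈ t
        · have h1 := hsum t
          have h2 := hc t ht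
          have h3 : ∑ i ∈ t, w'' i ≤ ∑ i ∈ t, w' i := Finset.sum_le_sum fun i _ => hw''le i
          simp [hxt] at h1
          omega
        · have h1 : ∀ i ∈ t, w'' i = ∑ k ∈ Finset.univ.erase k0, if i ∈ S k then 1 else 0 := by
            intro i hi
            have hix : i ≠ x := by rintro rfl; exact hxt hi
            have e1 := hadd i
            have e2 := hw''add i
            have e3 := hSw i
            rw [← Finset.add_sum_erase _ _ (Finset.mem_univ k0)] at e3
            simp only [hix, if_false] at e1
            omega
          rw [Finset.sum_congr rfl h1, Finset.sum_comm]
          refine (Finset.sum_le_sum fun k _ => hstab t ht k).trans ?_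
          simp)
    refine ⟨Fin.cons (S k0) T, ?_, ?_⟩
    · intro k
      refine Fin.cases ?_ ?_ k
      · simpa using hS k0
      · intro j; simpa using hT j
    · intro i
      rw [Fin.sum_univ_succ]
      simp only [Fin.cons_zero, Fin.cons_succ]
      rw [← hTw i]
      exact hw''add i

/-- Sums of `c` points of a convex set containing `0` lie in `s • A` for `c ≤ s`. -/
lemma exists_smul_eq_sum {d : ℕ} {A : Set (Fin d → ℝ)} (hA : Convex ℝ A) (h0 : (0 : Fin d → ℝ) ∈ A)
    (c : ℕ) (s : ℝ) (hs : (c : ℝ) ≤ s) (f : Fin c → Fin d → ℝ) (hf : ∀ k, f k ∈ A) :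
    ∃ y ∈ A, s • y = ∑ k, f k := by
  rcases Nat.eq_zero_or_pos c with rfl | hc
  · exact ⟨0, h0, by simp⟩
  have hc' : (0 : ℝ) < c := by exact_mod_cast hc
  have hs' : 0 < s := hc'.trans_le hs
  have hu : ∑ k, (c : ℝ)⁻¹ • f k ∈ A :=
    hA.sum_mem (fun _ _ => by positivity) (by simp [hc'.ne']) (fun k _ => hf k)
  refine ⟨((c : ℝ) / s) • ∑ k, (c : ℝ)⁻¹ • f k,
    hA.smul_mem_of_zero_mem h0 hu ⟨by positivity, (div_le_one hs').2 hs⟩, ?_⟩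
  rw [← Finset.smul_sum, smul_smul, smul_smul]
  have : s * (↑c / s) * (↑c)⁻¹ = (1 : ℝ) := by field_simp
  rw [this, one_smul]

lemma zero_mem_orderPolytope {d : ℕ} (P : PartialOrder (Fin d)) : 0 ∈ orderPolytope P :=
  subset_convexHull _ _ ⟨∅, by intro i hi; simp at hi, by ext i; simp [indicator]⟩

lemma zero_mem_stableSetPolytope {d : ℕ} (G : SimpleGraph (Fin d)) : 0 ∈ stableSetPolytope G :=
  subset_convexHull _ _ ⟨∅, by intro i hi; simp at hi, by ext i; simp [indicator]⟩

open Classical in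
lemma indicator_apply' {d : ℕ} (S : Set (Fin d)) (i : Fin d) :
    indicator S i = if i ∈ S then 1 else 0 := by
  simp [indicator, Set.indicator_apply]

lemma orderPolytope_prop {d : ℕ} (P : PartialOrder (Fin d)) {a : Fin d → ℝ}
    (ha : a ∈ orderPolytope P) :
    (∀ i, 0 ≤ a i) ∧ (∀ i, a i ≤ 1) ∧ ∀ i j, P.le i j → a j ≤ a i := by
  classical
  have hconv : Convex ℝ {a : Fin d → ℝ | (∀ i, 0 ≤ a i) ∧ (∀ i, a i ≤ 1) ∧
      ∀ i j, P.le i j → a j ≤ a i} := by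
    rintro a ⟨h1, h2, h3⟩ b ⟨g1, g2, g3⟩ u v hu hv huv
    refine ⟨fun i => ?_, fun i => ?_, fun i j hij => ?_⟩
    · have := h1 i; have := g1 i
      simp only [Pi.add_apply, Pi.smul_apply, smul_eq_mul]; positivity
    · have := h2 i; have := g2 i
      simp only [Pi.add_apply, Pi.smul_apply, smul_eq_mul]; nlinarith
    · have := h3 i j hij; have := g3 i j hij
      simp only [Pi.add_apply, Pi.smul_apply, smul_eq_mul]; gcongr
  refine convexHull_min ?_ hconv ha
  rintro _ ⟨I, hI, rfl⟩
  refine ⟨fun i => ?_, fun i => ?_, fun i j hij => ?_⟩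
  · rw [indicator_apply']; split_ifs <;> norm_num
  · rw [indicator_apply']; split_ifs <;> norm_num
  · rw [indicator_apply', indicator_apply']
    by_cases hj : j ∈ I
    · simp [hj, hI j hj i hij]
    · simp only [hj, if_false]; split_ifs <;> norm_num

lemma stableSetPolytope_prop {d : ℕ} (G : SimpleGraph (Fin d)) {b : Fin d → ℝ}
    (hb : b ∈ stableSetPolytope G) :
    (∀ i, 0 ≤ b i) ∧ ∀ t : Finset (Fin d), G.IsClique (t : Set (Fin d)) → ∑ i ∈ t, b i ≤ 1 := by
  classical
  have hconv : Convex ℝ {b : Fin d → ℝ | (∀ i, 0 ≤ b i) ∧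
      ∀ t : Finset (Fin d), G.IsClique (t : Set (Fin d)) → ∑ i ∈ t, b i ≤ 1} := by
    rintro a ⟨h1, h2⟩ b ⟨g1, g2⟩ u v hu hv huv
    refine ⟨fun i => ?_, fun t ht => ?_⟩
    · have := h1 i; have := g1 i
      simp only [Pi.add_apply, Pi.smul_apply, smul_eq_mul]; positivity
    · have := h2 t ht; have := g2 t ht
      simp only [Pi.add_apply, Pi.smul_apply, smul_eq_mul, Finset.sum_add_distrib,
        ← Finset.mul_sum]
      nlinarith
  refine convexHull_min ?_ hconv hb
  rintro _ ⟨S, hS, rfl⟩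
  refine ⟨fun i => ?_, fun t ht => ?_⟩
  · rw [indicator_apply']; split_ifs <;> norm_num
  · simp only [indicator_apply']
    rw [← Finset.natCast_card_filter]
    norm_cast
    rw [Finset.card_le_one]
    intro a ha b hb
    simp only [Finset.mem_filter] at ha hb
    by_contra hab
    exact hS a ha.2 b hb.2 (ht ha.1 hb.1 hab)

/-- Every lattice point `x` has a unique minimal pair `(s₀, r₀)` of dilation factors. -/
lemma exists_min_pair {d : ℕ} (P : PartialOrder (Fin d)) (G : SimpleGraph (Fin d))
    (hG : IsPerfectGraph G) (x : Fin d → ℤ) :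
    ∃ s₀ r₀ : ℕ, ∀ s r : ℝ, 0 ≤ s → 0 ≤ r →
      ((∃ a ∈ orderPolytope P, ∃ b ∈ stableSetPolytope G, ∀ i, (x i : ℝ) = s * a i - r * b i) ↔
        (s₀ : ℝ) ≤ s ∧ (r₀ : ℝ) ≤ r) := by
  classical
  set a : Fin d → ℕ := fun i => (Finset.univ.filter (fun j => P.le i j)).sup
    (fun j => (x j).toNat) with ha
  have hax : ∀ i, x i ≤ a i := by
    intro i
    have : (x i).toNat ≤ a i := Finset.le_sup (f := fun j => (x j).toNat)
      (Finset.mem_filter.2 ⟨Finset.mem_univ i, P.le_refl i⟩)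
    omega
  have hanti : ∀ i j, P.le i j → a j ≤ a i := by
    intro i j hij
    refine Finset.sup_mono ?_
    intro k hk
    simp only [Finset.mem_filter, Finset.mem_univ, true_and] at hk ⊢
    exact P.le_trans _ _ _ hij hk
  set b : Fin d → ℕ := fun i => ((a i : ℤ) - x i).toNat with hb
  have hbx : ∀ i, (x i : ℤ) = a i - b i := by
    intro i
    have := hax i
    simp only [hb]
    omega
  have hbxR : ∀ i, (x i : ℝ) = a i - b i := by
    intro i
    exact_mod_cast hbx i
  set s₀ : ℕ := Finset.univ.sup a with hs₀
  set r₀ : ℕ := (Finset.univ.filter (fun t : Finset (Fin d) => G.IsClique (t : Set (Fin d)))).sup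
    (fun t => ∑ i ∈ t, b i) with hr₀
  refine ⟨s₀, r₀, fun s r hs hr => ⟨?_, ?_⟩⟩
  · rintro ⟨a', ha', b', hb', hx⟩
    obtain ⟨A1, A2, A3⟩ := orderPolytope_prop P ha'
    obtain ⟨B1, B2⟩ := stableSetPolytope_prop G hb'
    have haa : ∀ i, (a i : ℝ) ≤ s * a' i := by
      intro i
      have hnn : 0 ≤ s * a' i := mul_nonneg hs (A1 i)
      refine le_trans ?_ (Nat.floor_le hnn)
      rw [Nat.cast_le]
      refine Finset.sup_le fun j hj => ?_
      simp only [Finset.mem_filter, Finset.mem_univ, true_and] at hj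
      refine Nat.le_floor ?_
      have h1 : (x j : ℝ) ≤ s * a' i := by
        have h2 := mul_nonneg hr (B1 j)
        have h3 := mul_le_mul_of_nonneg_left (A3 i j hj) hs
        rw [hx j]; linarith
      have h4 : ((x j).toNat : ℝ) = max (x j : ℝ) 0 := by
        have : (((x j).toNat : ℤ) : ℝ) = ((max (x j) 0 : ℤ) : ℝ) := by rw [Int.toNat_eq_max]
        push_cast at this
        exact this
      rw [h4]
      exact max_le h1 hnn
    have hbb : ∀ i, (b i : ℝ) ≤ r * b' i := by
      intro i
      have h1 := haa i
      have h2 := hbxR i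
      have h3 := hx i
      linarith
    constructor
    · refine le_trans ?_ (Nat.floor_le hs)
      rw [Nat.cast_le]
      refine Finset.sup_le fun i _ => Nat.le_floor ((haa i).trans ?_)
      exact mul_le_of_le_one_right hs (A2 i)
    · refine le_trans ?_ (Nat.floor_le hr)
      rw [Nat.cast_le]
      refine Finset.sup_le fun t ht => Nat.le_floor ?_
      simp only [Finset.mem_filter, Finset.mem_univ, true_and] at ht
      push_cast
      calc ∑ i ∈ t, (b i : ℝ) ≤ ∑ i ∈ t, r * b' i := Finset.sum_le_sum fun i _ => hbb i
        _ = r * ∑ i ∈ t, b' i := by rw [Finset.mul_sum]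
        _ ≤ r := mul_le_of_le_one_right hr (B2 t ht)
  · rintro ⟨hs0, hr0⟩
    obtain ⟨f, hf, hfb⟩ := weighted_coloring G hG _ b r₀ le_rfl (fun t ht =>
      Finset.le_sup (f := fun t => ∑ i ∈ t, b i) (by simpa using ht))
    obtain ⟨b', hb', hbe⟩ := exists_smul_eq_sum (convex_convexHull ℝ _)
      (zero_mem_stableSetPolytope G) r₀ r hr0 (fun k => indicator (f k))
      (fun k => subset_convexHull _ _ ⟨f k, hf k, rfl⟩)
    obtain ⟨a', ha', hae⟩ := exists_smul_eq_sum (convex_convexHull ℝ _)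
      (zero_mem_orderPolytope P) s₀ s hs0 (fun k => indicator {i | (k : ℕ) < a i})
      (fun k => subset_convexHull _ _ ⟨_, (by
        intro i hi j hji
        exact lt_of_lt_of_le hi (hanti j i hji)), rfl⟩)
    refine ⟨a', ha', b', hb', fun i => ?_⟩
    have e1 := congrFun hae i
    have e2 := congrFun hbe i
    simp only [Pi.smul_apply, smul_eq_mul, Finset.sum_apply, indicator_apply'] at e1 e2
    have e3 : (b i : ℝ) = r * b' i := by
      rw [e2, hfb i]; push_cast; rfl
    have e4 : (a i : ℝ) = s * a' i := by
      have h1 : a i ≤ s₀ := Finset.le_sup (Finset.mem_univ i)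
      have e5 : (∑ k : Fin s₀, if (k : ℕ) < a i then (1 : ℝ) else 0) = a i := by
        rw [Fin.sum_univ_eq_sum_range (fun k => if k < a i then (1 : ℝ) else 0) s₀,
          ← Finset.natCast_card_filter]
        congr 1
        have : (Finset.range s₀).filter (fun k => k < a i) = Finset.range (a i) := by
          ext k; simp; omega
        rw [this, Finset.card_range]
      rw [e1, ← e5]
      refine Finset.sum_congr rfl fun k _ => ?_
      by_cases hk : (k : ℕ) < a i <;> simp [hk]
    rw [hbxR i, e3, e4]

lemma mem_smul_gamma {d : ℕ} {A B : Set (Fin d → ℝ)} (hA : Convex ℝ A) (hB : Convex ℝ B)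
    (hA0 : (0 : Fin d → ℝ) ∈ A) (hB0 : (0 : Fin d → ℝ) ∈ B) (m : ℕ) (x : Fin d → ℝ) :
    x ∈ (m : ℝ) • gammaPolytope A B ↔
      ∃ s r : ℝ, 0 ≤ s ∧ 0 ≤ r ∧ s + r = m ∧ ∃ a ∈ A, ∃ b ∈ B, ∀ i, x i = s * a i - r * b i := by
  rw [gammaPolytope, hA.convexHull_union hB.neg ⟨0, hA0⟩ ⟨0, by simpa using hB0⟩]
  constructor
  · rintro ⟨y, hy, rfl⟩
    rw [mem_convexJoin] at hy
    obtain ⟨a, ha, b, hb, u, v, hu, hv, huv, rfl⟩ := hy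
    refine ⟨m * u, m * v, by positivity, by positivity, by rw [← mul_add, huv, mul_one],
      a, ha, -b, hb, fun i => ?_⟩
    simp
    ring
  · rintro ⟨s, r, hs, hr, hsr, a, ha, b, hb, hx⟩
    rcases Nat.eq_zero_or_pos m with rfl | hm
    · have hs0 : s = 0 := by push_cast at hsr; linarith
      have hr0 : r = 0 := by push_cast at hsr; linarith
      refine ⟨0, ?_, ?_⟩
      · rw [mem_convexJoin]
        exact ⟨0, hA0, 0, by simpa using hB0, left_mem_segment _ _ _⟩
      · ext i; simp [hx i, hs0, hr0]
    have hm' : (0 : ℝ) < m := by exact_mod_cast hm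
    refine ⟨(s / m) • a + (r / m) • (-b), ?_, ?_⟩
    · rw [mem_convexJoin]
      refine ⟨a, ha, -b, by simpa using hb, s / m, r / m, by positivity, by positivity, ?_, rfl⟩
      rw [← add_div, hsr, div_self hm'.ne']
    · ext i
      simp [hx i]
      field_simp
      ring

lemma mem_smul_omega {d : ℕ} {A B : Set (Fin d → ℝ)} (hA : Convex ℝ A) (hB : Convex ℝ B)
    (hA0 : (0 : Fin d → ℝ) ∈ A) (hB0 : (0 : Fin d → ℝ) ∈ B) (m : ℕ) (x : Fin d → ℝ) (t : ℝ) :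
    (Fin.snoc x t : Fin (d + 1) → ℝ) ∈ (m : ℝ) • omegaPolytope A B ↔
      ∃ s r : ℝ, 0 ≤ s ∧ 0 ≤ r ∧ s + r = m ∧ s - r = t ∧
        ∃ a ∈ A, ∃ b ∈ B, ∀ i, x i = s * a i - r * b i := by
  have hconv : ∀ (C : Set (Fin d → ℝ)) (c : ℝ), Convex ℝ C →
      Convex ℝ ((fun x : Fin d → ℝ => (Fin.snoc x c : Fin (d + 1) → ℝ)) '' C) := by
    rintro C c hC _ ⟨y, hy, rfl⟩ _ ⟨z, hz, rfl⟩ u v hu hv huv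
    refine ⟨u • y + v • z, hC hy hz hu hv huv, ?_⟩
    ext i
    refine Fin.lastCases ?_ (fun i => ?_) i
    · simp [← add_mul, huv]
    · simp
  rw [omegaPolytope, (hconv A 1 hA).convexHull_union (hconv (-B) (-1) hB.neg) ⟨_, 0, hA0, rfl⟩
    ⟨_, 0, by simpa using hB0, rfl⟩]
  constructor
  · rintro ⟨y, hy, hyx⟩
    rw [mem_convexJoin] at hy
    obtain ⟨_, ⟨a, ha, rfl⟩, _, ⟨b, hb, rfl⟩, u, v, hu, hv, huv, rfl⟩ := hy
    refine ⟨m * u, m * v, by positivity, by positivity, by rw [← mul_add, huv, mul_one],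
      ?_, a, ha, -b, hb, fun i => ?_⟩
    · have := congrFun hyx (Fin.last d)
      simp at this
      rw [← this]; ring
    · have := congrFun hyx i.castSucc
      simp at this
      rw [← this]
      simp
      ring
  · rintro ⟨s, r, hs, hr, hsr, hst, a, ha, b, hb, hx⟩
    rcases Nat.eq_zero_or_pos m with rfl | hm
    · have hs0 : s = 0 := by push_cast at hsr; linarith
      have hr0 : r = 0 := by push_cast at hsr; linarith
      refine ⟨Fin.snoc 0 1, ?_, ?_⟩
      · rw [mem_convexJoin]
        exact ⟨_, ⟨0, hA0, rfl⟩, _, ⟨0, by simpa using hB0, rfl⟩, left_mem_segment _ _ _⟩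
      · ext i
        refine Fin.lastCases ?_ (fun i => ?_) i
        · simp [← hst, hs0, hr0]
        · simp [hx i, hs0, hr0]
    have hm' : (0 : ℝ) < m := by exact_mod_cast hm
    refine ⟨(s / m) • Fin.snoc a 1 + (r / m) • Fin.snoc (-b) (-1), ?_, ?_⟩
    · rw [mem_convexJoin]
      refine ⟨_, ⟨a, ha, rfl⟩, _, ⟨-b, by simpa using hb, rfl⟩, s / m, r / m,
        by positivity, by positivity, ?_, rfl⟩
      rw [← add_div, hsr, div_self hm'.ne']
    · ext i
      refine Fin.lastCases ?_ (fun i => ?_) i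
      · simp [← hst]
        field_simp
        ring
      · simp [hx i]
        field_simp
        ring

lemma latticePointCount_zero_smul {n : ℕ} (Q : Set (Fin n → ℝ)) (h : Q.Nonempty) :
    latticePointCount (((0 : ℕ) : ℝ) • Q) = 1 := by
  rw [latticePointCount, Nat.cast_zero, Set.zero_smul_set h, Set.ncard_eq_one]
  refine ⟨0, ?_⟩
  ext x
  simp only [Set.mem_ofPred_eq, Set.mem_zero, Set.mem_singleton_iff, and_iff_left_iff_imp]
  rintro rfl i
  exact ⟨0, by simp⟩

lemma ehrhartSeries_eq {n : ℕ} (Q : Set (Fin n → ℝ)) (h : Q.Nonempty) :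
    ehrhartSeries Q = PowerSeries.mk fun m => (latticePointCount ((m : ℝ) • Q) : ℚ) := by
  rw [ehrhartSeries]
  congr 1
  ext m
  split_ifs with hm
  · subst hm
    rw [latticePointCount_zero_smul Q h]; simp
  · rfl

lemma latticePointCount_gamma {d : ℕ} {A B : Set (Fin d → ℝ)} (hA : Convex ℝ A) (hB : Convex ℝ B)
    (hA0 : (0 : Fin d → ℝ) ∈ A) (hB0 : (0 : Fin d → ℝ) ∈ B) (s₀ r₀ : (Fin d → ℤ) → ℕ)
    (H : ∀ x : Fin d → ℤ, ∀ s r : ℝ, 0 ≤ s → 0 ≤ r →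
      ((∃ a ∈ A, ∃ b ∈ B, ∀ i, (x i : ℝ) = s * a i - r * b i) ↔
        (s₀ x : ℝ) ≤ s ∧ (r₀ x : ℝ) ≤ r)) (m : ℕ) :
    latticePointCount ((m : ℝ) • gammaPolytope A B) =
      Set.ncard {x : Fin d → ℤ | s₀ x + r₀ x ≤ m} := by
  rw [latticePointCount]
  have hinj : Function.Injective (fun (x : Fin d → ℤ) (i : Fin d) => (x i : ℝ)) := by
    intro x y hxy
    ext i
    have := congrFun hxy i
    simpa using this
  rw [← Set.ncard_image_of_injective _ hinj]
  congr 1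
  have key : ∀ x : Fin d → ℤ, (fun i => (x i : ℝ)) ∈ (m : ℝ) • gammaPolytope A B ↔
      s₀ x + r₀ x ≤ m := by
    intro x
    rw [mem_smul_gamma hA hB hA0 hB0]
    constructor
    · rintro ⟨s, r, hs, hr, hsr, h⟩
      have := (H x s r hs hr).1 h
      have h2 : (s₀ x : ℝ) + r₀ x ≤ m := by linarith
      exact_mod_cast h2
    · intro h
      have h2 : (s₀ x : ℝ) + r₀ x ≤ m := by exact_mod_cast h
      have h3 : (0 : ℝ) ≤ r₀ x := by positivity
      have h4 : (0 : ℝ) ≤ s₀ x := by positivity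
      exact ⟨s₀ x, m - s₀ x, h4, by linarith, by ring,
        (H x _ _ h4 (by linarith)).2 ⟨le_rfl, by linarith⟩⟩
  ext y
  simp only [Set.mem_ofPred_eq, Set.mem_image]
  constructor
  · rintro ⟨hy, hl⟩
    choose z hz using hl
    obtain rfl : y = fun i => (z i : ℝ) := funext hz
    exact ⟨z, (key z).1 hy, rfl⟩
  · rintro ⟨z, hz, rfl⟩
    exact ⟨(key z).2 hz, fun i => ⟨z i, rfl⟩⟩

lemma latticePointCount_omega {d : ℕ} {A B : Set (Fin d → ℝ)} (hA : Convex ℝ A) (hB : Convex ℝ B)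
    (hA0 : (0 : Fin d → ℝ) ∈ A) (hB0 : (0 : Fin d → ℝ) ∈ B) (s₀ r₀ : (Fin d → ℤ) → ℕ)
    (H : ∀ x : Fin d → ℤ, ∀ s r : ℝ, 0 ≤ s → 0 ≤ r →
      ((∃ a ∈ A, ∃ b ∈ B, ∀ i, (x i : ℝ) = s * a i - r * b i) ↔
        (s₀ x : ℝ) ≤ s ∧ (r₀ x : ℝ) ≤ r)) (m : ℕ) :
    latticePointCount ((m : ℝ) • omegaPolytope A B) =
      Set.ncard {p : (Σ _ : Fin d → ℤ, ℤ) |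
        (2 * s₀ p.1 : ℤ) - m ≤ p.2 ∧ p.2 ≤ (m : ℤ) - 2 * r₀ p.1} := by
  rw [latticePointCount]
  have hinj : Function.Injective (fun (p : Σ _ : Fin d → ℤ, ℤ) =>
      (Fin.snoc (fun i => (p.1 i : ℝ)) (p.2 : ℝ) : Fin (d + 1) → ℝ)) := by
    rintro ⟨x, t⟩ ⟨y, u⟩ hxy
    have h1 : x = y := by
      ext i
      have := congrFun hxy i.castSucc
      simpa using this
    have h2 : t = u := by
      have := congrFun hxy (Fin.last d)
      simpa using this
    rw [h1, h2]
  rw [← Set.ncard_image_of_injective _ hinj]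
  congr 1
  have key : ∀ (x : Fin d → ℤ) (t : ℤ),
      (Fin.snoc (fun i => (x i : ℝ)) (t : ℝ) : Fin (d + 1) → ℝ) ∈ (m : ℝ) • omegaPolytope A B ↔
      (2 * s₀ x : ℤ) - m ≤ t ∧ t ≤ (m : ℤ) - 2 * r₀ x := by
    intro x t
    rw [mem_smul_omega hA hB hA0 hB0]
    have e : ((2 * s₀ x : ℤ) - m ≤ t ∧ t ≤ (m : ℤ) - 2 * r₀ x) ↔
        ((2 * s₀ x : ℝ) - m ≤ t ∧ (t : ℝ) ≤ (m : ℝ) - 2 * r₀ x) := by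
      constructor
      · rintro ⟨h1, h2⟩
        exact ⟨by exact_mod_cast h1, by exact_mod_cast h2⟩
      · rintro ⟨h1, h2⟩
        exact ⟨by exact_mod_cast h1, by exact_mod_cast h2⟩
    rw [e]
    constructor
    · rintro ⟨s, r, hs, hr, hsr, hst, h⟩
      have := (H x s r hs hr).1 h
      constructor <;> linarith
    · rintro ⟨h1, h2⟩
      have h3 : (0 : ℝ) ≤ r₀ x := by positivity
      have h4 : (0 : ℝ) ≤ s₀ x := by positivity
      exact ⟨(m + t) / 2, (m - t) / 2, by linarith, by linarith, by ring, by ring,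
        (H x _ _ (by linarith) (by linarith)).2 ⟨by linarith, by linarith⟩⟩
  ext y
  simp only [Set.mem_ofPred_eq, Set.mem_image]
  constructor
  · rintro ⟨hy, hl⟩
    choose z hz using hl
    obtain rfl : y = Fin.snoc (fun i : Fin d => (z i.castSucc : ℝ)) (z (Fin.last d) : ℝ) := by
      ext i
      refine Fin.lastCases ?_ (fun i => ?_) i
      · simp [hz]
      · simp [hz]
    exact ⟨⟨fun i => z i.castSucc, z (Fin.last d)⟩, (key _ _).1 hy, rfl⟩
  · rintro ⟨⟨x, t⟩, hz, rfl⟩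
    refine ⟨(key x t).2 hz, fun i => ?_⟩
    refine Fin.lastCases ?_ (fun i => ?_) i
    · exact ⟨t, by simp⟩
    · exact ⟨x i, by simp⟩

/-- The counting recurrence. -/
lemma count_recurrence {X : Type*} (s₀ r₀ : X → ℕ)
    (hfin : ∀ m : ℕ, {x | s₀ x + r₀ x ≤ m}.Finite) (m : ℕ) :
    Set.ncard {p : (Σ _ : X, ℤ) |
        (2 * s₀ p.1 : ℤ) - (m + 1 : ℕ) ≤ p.2 ∧ p.2 ≤ ((m + 1 : ℕ) : ℤ) - 2 * r₀ p.1} =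
      Set.ncard {p : (Σ _ : X, ℤ) |
        (2 * s₀ p.1 : ℤ) - m ≤ p.2 ∧ p.2 ≤ (m : ℤ) - 2 * r₀ p.1} +
      (Set.ncard {x | s₀ x + r₀ x ≤ m + 1} + Set.ncard {x | s₀ x + r₀ x ≤ m}) := by
  classical
  set F := (hfin (m + 1)).toFinset with hF
  have hmem : ∀ x, x ∈ F ↔ s₀ x + r₀ x ≤ m + 1 := by intro x; simp [hF]
  have hW : ∀ k ≤ m + 1, Set.ncard {p : (Σ _ : X, ℤ) |
        (2 * s₀ p.1 : ℤ) - k ≤ p.2 ∧ p.2 ≤ (k : ℤ) - 2 * r₀ p.1} =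
      ∑ x ∈ F, (Finset.Icc ((2 * s₀ x : ℤ) - k) ((k : ℤ) - 2 * r₀ x)).card := by
    intro k hk
    rw [← Finset.card_sigma, ← Set.ncard_coe_finset]
    congr 1
    ext ⟨x, t⟩
    simp only [Set.mem_ofPred_eq, Finset.coe_sigma, Set.mem_sigma_iff, Finset.mem_coe, hmem,
      Finset.mem_Icc]
    constructor
    · rintro ⟨h1, h2⟩
      exact ⟨by omega, h1, h2⟩
    · rintro ⟨_, h⟩
      exact h
  have hN : ∀ k ≤ m + 1, Set.ncard {x | s₀ x + r₀ x ≤ k} =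
      ∑ x ∈ F, if s₀ x + r₀ x ≤ k then 1 else 0 := by
    intro k hk
    rw [← Finset.card_filter, ← Set.ncard_coe_finset]
    congr 1
    ext x
    simp only [Set.mem_ofPred_eq, Finset.coe_filter, hmem]
    omega
  rw [hW (m + 1) le_rfl, hW m (by omega), hN (m + 1) le_rfl, hN m (by omega),
    ← Finset.sum_add_distrib, ← Finset.sum_add_distrib]
  refine Finset.sum_congr rfl fun x hx => ?_
  rw [hmem] at hx
  simp only [Int.card_Icc, hx, if_true]
  split_ifs <;> omega

/-- For a poset `P` on `[d]` and a perfect graph `G` on `[d]` (`d ≥ 1`),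
`δ(Ω(O_P, Q_G), λ) = (1 + λ) · δ(Γ(O_P, Q_G), λ)`. -/
theorem delta_omega_eq_one_add_mul_delta_gamma (d : ℕ) (hd : 1 ≤ d)
    (P : PartialOrder (Fin d)) (G : SimpleGraph (Fin d)) (hG : IsPerfectGraph G) :
    deltaPolynomial (omegaPolytope (orderPolytope P) (stableSetPolytope G)) =
      (1 + PowerSeries.X) *
        deltaPolynomial (gammaPolytope (orderPolytope P) (stableSetPolytope G)) := by
  have hA : Convex ℝ (orderPolytope P) := convex_convexHull ℝ _
  have hB : Convex ℝ (stableSetPolytope G) := convex_convexHull ℝ _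
  have hA0 := zero_mem_orderPolytope P
  have hB0 := zero_mem_stableSetPolytope G
  choose s₀ r₀ H using exists_min_pair P G hG
  have hfin : ∀ m : ℕ, {x | s₀ x + r₀ x ≤ m}.Finite := by
    intro m
    refine (Set.finite_Icc (fun _ => -(m : ℤ) : Fin d → ℤ) (fun _ => (m : ℤ))).subset ?_
    intro x hx
    have hx' : (s₀ x : ℝ) + r₀ x ≤ m := by exact_mod_cast hx
    have hs : (0 : ℝ) ≤ s₀ x := by positivity
    have hr : (0 : ℝ) ≤ r₀ x := by positivity
    obtain ⟨a, ha, b, hb, hxe⟩ := (H x (s₀ x) (r₀ x) hs hr).2 ⟨le_rfl, le_rfl⟩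
    obtain ⟨A1, A2, -⟩ := orderPolytope_prop P ha
    obtain ⟨B1, B2⟩ := stableSetPolytope_prop G hb
    have B3 : ∀ i, b i ≤ 1 := fun i => by simpa using B2 {i} (by simp)
    have key : ∀ i, -(m : ℝ) ≤ x i ∧ (x i : ℝ) ≤ m := by
      intro i
      rw [hxe i]
      have h1 := mul_le_of_le_one_right hs (A2 i)
      have h2 := mul_le_of_le_one_right hr (B3 i)
      have h3 := mul_nonneg hs (A1 i)
      have h4 := mul_nonneg hr (B1 i)
      constructor <;> linarith
    exact ⟨fun i => by exact_mod_cast (key i).1, fun i => by exact_mod_cast (key i).2⟩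
  have hΓne : (gammaPolytope (orderPolytope P) (stableSetPolytope G)).Nonempty :=
    ⟨0, subset_convexHull _ _ (Or.inl hA0)⟩
  have hΩne : (omegaPolytope (orderPolytope P) (stableSetPolytope G)).Nonempty :=
    ⟨_, subset_convexHull _ _ (Or.inl ⟨0, hA0, rfl⟩)⟩
  have hser : (1 - PowerSeries.X) *
      ehrhartSeries (omegaPolytope (orderPolytope P) (stableSetPolytope G)) =
      (1 + PowerSeries.X) *
        ehrhartSeries (gammaPolytope (orderPolytope P) (stableSetPolytope G)) := by
    rw [ehrhartSeries_eq _ hΓne, ehrhartSeries_eq _ hΩne]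
    ext m
    rw [sub_mul, add_mul, one_mul, one_mul, map_sub, map_add]
    cases m with
    | zero =>
      rw [PowerSeries.coeff_zero_X_mul, PowerSeries.coeff_zero_X_mul, PowerSeries.coeff_mk,
        PowerSeries.coeff_mk, latticePointCount_zero_smul _ hΓne,
        latticePointCount_zero_smul _ hΩne]
      simp
    | succ m =>
      rw [PowerSeries.coeff_succ_X_mul, PowerSeries.coeff_succ_X_mul]
      simp only [PowerSeries.coeff_mk]
      rw [latticePointCount_gamma hA hB hA0 hB0 s₀ r₀ H, latticePointCount_gamma hA hB hA0 hB0 s₀ r₀ H,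
        latticePointCount_omega hA hB hA0 hB0 s₀ r₀ H, latticePointCount_omega hA hB hA0 hB0 s₀ r₀ H,
        count_recurrence s₀ r₀ hfin m]
      push_cast
      ring
  rw [deltaPolynomial, deltaPolynomial, pow_succ, mul_assoc, hser]
  ring

end HibiTsuchiya
end

section
/- Let G be a finite simple graph on [d] = {1,...,d} that has an odd hole, i.e., an induced odd cycle of length ≥ 5. Then for every finite partially ordered set P on [d], the polytope Γ(O_P, Q_G) = conv(O_P ∪ (−Q_G)) is not reflexive. -/
open scoped Pointwise

namespace HibiTsuchiya

/-- The adjacency relation of the cycle of length `m` on `ZMod m`. -/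
def cycleAdj (m : ℕ) (i j : ZMod m) : Prop := i ≠ j ∧ (j = i + 1 ∨ i = j + 1)

/-- `G` has an *odd hole*: an induced odd cycle of length `2ℓ+1 ≥ 5`. -/
def HasOddHole {n : ℕ} (G : SimpleGraph (Fin n)) : Prop :=
  ∃ ℓ : ℕ, 2 ≤ ℓ ∧ ∃ f : ZMod (2 * ℓ + 1) → Fin n, Function.Injective f ∧
    ∀ i j, G.Adj (f i) (f j) ↔ cycleAdj (2 * ℓ + 1) i j

/-- `G` has an *odd antihole*: an induced subgraph whose complement is an odd cycle of
length `2ℓ+1 ≥ 5`. -/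
def HasOddAntihole {n : ℕ} (G : SimpleGraph (Fin n)) : Prop :=
  ∃ ℓ : ℕ, 2 ≤ ℓ ∧ ∃ f : ZMod (2 * ℓ + 1) → Fin n, Function.Injective f ∧
    ∀ i j, G.Adj (f i) (f j) ↔ (i ≠ j ∧ ¬ cycleAdj (2 * ℓ + 1) i j)

/-- The point `-(1/ℓ) ρ(C)` for the odd hole `C`. -/
noncomputable def holePt {d : ℕ} (ℓ : ℕ) (f : ZMod (2 * ℓ + 1) → Fin d) : Fin d → ℝ :=
  fun i => ∑ j, if f j = i then -(1 / (ℓ : ℝ)) else 0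

lemma sum_holePt {d : ℕ} (ℓ : ℕ) (f : ZMod (2 * ℓ + 1) → Fin d) (y : Fin d → ℝ) :
    ∑ i, holePt ℓ f i * y i = -(1 / (ℓ : ℝ)) * ∑ j, y (f j) := by
  simp only [holePt, Finset.sum_mul]
  rw [Finset.sum_comm, Finset.mul_sum]
  refine Finset.sum_congr rfl fun j _ => ?_
  simp [ite_mul]

lemma holePt_apply {d : ℕ} (ℓ : ℕ) (f : ZMod (2 * ℓ + 1) → Fin d)
    (hf : Function.Injective f) (j : ZMod (2 * ℓ + 1)) :
    holePt ℓ f (f j) = -(1 / (ℓ : ℝ)) := by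
  simp [holePt, hf.eq_iff]

lemma convex_half {d : ℕ} (x : Fin d → ℝ) (c : ℝ) :
    Convex ℝ {y : Fin d → ℝ | ∑ i, x i * y i ≤ c} := by
  apply convex_halfSpace_le
  constructor
  · intro a b
    simp [mul_add, Finset.sum_add_distrib]
  · intro a b
    simp only [Pi.smul_apply, smul_eq_mul, Finset.mul_sum]
    exact Finset.sum_congr rfl fun i _ => by ring

lemma card_stable_le {d : ℕ} {G : SimpleGraph (Fin d)} {ℓ : ℕ} (hl : 2 ≤ ℓ)
    {f : ZMod (2 * ℓ + 1) → Fin d}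
    (hG : ∀ i j, G.Adj (f i) (f j) ↔ cycleAdj (2 * ℓ + 1) i j)
    {S : Set (Fin d)} (hS : IsStableSet G S) :
    ∑ j, indicator S (f j) ≤ (ℓ : ℝ) := by
  classical
  have h10 : (1 : ZMod (2 * ℓ + 1)) ≠ 0 := by
    have : Fact (1 < 2 * ℓ + 1) := ⟨by omega⟩
    exact one_ne_zero
  have hpair : ∀ j, indicator S (f j) + indicator S (f (j + 1)) ≤ 1 := by
    intro j
    have hadj : G.Adj (f j) (f (j + 1)) := by
      rw [hG]
      exact ⟨fun h => h10 (by simpa using h), Or.inl rfl⟩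
    unfold indicator
    by_cases h1 : f j ∈ S
    · by_cases h2 : f (j + 1) ∈ S
      · exact absurd hadj (hS _ h1 _ h2)
      · simp [h1, h2]
    · by_cases h2 : f (j + 1) ∈ S <;> simp [h1, h2]
  set A : Finset (ZMod (2 * ℓ + 1)) := Finset.univ.filter fun j => f j ∈ S with hA
  have hsum : ∑ j, indicator S (f j) = (A.card : ℝ) := by
    simp [indicator, Set.indicator_apply, hA]
  have hshift : ∑ j, indicator S (f (j + 1)) = ∑ j, indicator S (f j) :=
    Equiv.sum_comp (Equiv.addRight (1 : ZMod (2 * ℓ + 1))) (fun j => indicator S (f j))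
  have htot : ∑ j : ZMod (2 * ℓ + 1), (indicator S (f j) + indicator S (f (j + 1)))
      ≤ ∑ j : ZMod (2 * ℓ + 1), (1 : ℝ) := Finset.sum_le_sum fun j _ => hpair j
  rw [Finset.sum_add_distrib, hshift, hsum] at htot
  have h2 : ((A.card + A.card : ℕ) : ℝ) ≤ ((2 * ℓ + 1 : ℕ) : ℝ) := by
    simpa [ZMod.card] using htot
  have h3 : A.card + A.card ≤ 2 * ℓ + 1 := by exact_mod_cast h2
  rw [hsum]
  exact_mod_cast (by omega : A.card ≤ ℓ)

lemma cast_inj_of_lt {n a b : ℕ} (ha : a < n) (hb : b < n) (h : (a : ZMod n) = b) : a = b := by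
  rw [ZMod.natCast_eq_natCast_iff] at h
  exact Nat.ModEq.eq_of_lt_of_lt h ha hb

/-- For a point `v` of the dual polytope, summing over all the maximum stable sets of the hole. -/
lemma sum_le_of_dual {d : ℕ} {G : SimpleGraph (Fin d)} {P : PartialOrder (Fin d)} {ℓ : ℕ}
    {f : ZMod (2 * ℓ + 1) → Fin d} (hf : Function.Injective f)
    (hG : ∀ i j, G.Adj (f i) (f j) ↔ cycleAdj (2 * ℓ + 1) i j)
    {v : Fin d → ℝ}
    (hv : v ∈ dualPolytope (gammaPolytope (orderPolytope P) (stableSetPolytope G))) :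
    (ℓ : ℝ) * ∑ j, - v (f j) ≤ 2 * ℓ + 1 := by
  classical
  have key : ∀ i : ZMod (2 * ℓ + 1),
      ∑ k ∈ Finset.range ℓ, - v (f (i + ((2 * k : ℕ) : ZMod (2 * ℓ + 1)))) ≤ 1 := by
    intro i
    set g : ℕ → Fin d := fun k => f (i + ((2 * k : ℕ) : ZMod (2 * ℓ + 1))) with hg
    have ginj : Set.InjOn g (Finset.range ℓ : Set ℕ) := by
      intro a ha b hb hab
      have ha' : a < ℓ := by simpa using ha
      have hb' : b < ℓ := by simpa using hb
      have h1 := add_left_cancel (hf hab)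
      have := cast_inj_of_lt (by omega) (by omega) h1
      omega
    have hstable : IsStableSet G ((Finset.range ℓ).image g : Set (Fin d)) := by
      intro a ha b hb hab
      simp only [Finset.coe_image, Set.mem_image, Finset.coe_range, Set.mem_Iio] at ha hb
      obtain ⟨k, hk, rfl⟩ := ha
      obtain ⟨m, hm, rfl⟩ := hb
      rw [hg, hG] at hab
      rcases hab.2 with h | h
      · rw [add_assoc] at h
        have h1 := add_left_cancel h
        have h2 : ((2 * m : ℕ) : ZMod (2 * ℓ + 1)) = ((2 * k + 1 : ℕ) : ZMod (2 * ℓ + 1)) := by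
          rw [h1]; push_cast; ring
        have := cast_inj_of_lt (by omega) (by omega) h2
        omega
      · rw [add_assoc] at h
        have h1 := add_left_cancel h
        have h2 : ((2 * k : ℕ) : ZMod (2 * ℓ + 1)) = ((2 * m + 1 : ℕ) : ZMod (2 * ℓ + 1)) := by
          rw [h1]; push_cast; ring
        have := cast_inj_of_lt (by omega) (by omega) h2
        omega
    have hmem : -indicator ((Finset.range ℓ).image g : Set (Fin d)) ∈
        gammaPolytope (orderPolytope P) (stableSetPolytope G) := by
      apply subset_convexHull
      right
      rw [Set.mem_neg, neg_neg]
      apply subset_convexHull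
      exact ⟨_, hstable, rfl⟩
    have h := hv _ hmem
    have h2 : ∑ i, v i * (-indicator ((Finset.range ℓ).image g : Set (Fin d))) i
        = ∑ k ∈ Finset.range ℓ, - v (g k) := by
      rw [← Finset.sum_image (f := fun x => - v x) ginj]
      simp [indicator, Set.indicator_apply, -Finset.coe_image, -Finset.mem_image, Finset.sum_ite_mem]
    rw [h2] at h
    exact h
  have htot := Finset.sum_le_sum fun (i : ZMod (2 * ℓ + 1)) (_ : i ∈ Finset.univ) => key i
  rw [Finset.sum_comm] at htot
  have hshift : ∀ k : ℕ, ∑ i, - v (f (i + ((2 * k : ℕ) : ZMod (2 * ℓ + 1)))) = ∑ i, - v (f i) :=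
    fun k => Equiv.sum_comp (Equiv.addRight ((2 * k : ℕ) : ZMod (2 * ℓ + 1)))
      (fun j => - v (f j))
  rw [Finset.sum_congr rfl fun k _ => hshift k] at htot
  simpa [ZMod.card, -Finset.sum_neg_distrib] using htot

lemma holePt_mem {d : ℕ} {G : SimpleGraph (Fin d)} {P : PartialOrder (Fin d)} {ℓ : ℕ}
    (hl : 2 ≤ ℓ) {f : ZMod (2 * ℓ + 1) → Fin d}
    (hG : ∀ i j, G.Adj (f i) (f j) ↔ cycleAdj (2 * ℓ + 1) i j) :
    holePt ℓ f ∈ dualPolytope (gammaPolytope (orderPolytope P) (stableSetPolytope G)) := by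
  have hl0 : (0 : ℝ) < ℓ := by exact_mod_cast (by omega : 0 < ℓ)
  suffices h : gammaPolytope (orderPolytope P) (stableSetPolytope G) ⊆
      {y | ∑ i, holePt ℓ f i * y i ≤ 1} from fun y hy => h hy
  refine convexHull_min (Set.union_subset ?_ ?_) (convex_half _ _)
  · refine convexHull_min ?_ (convex_half _ _)
    rintro _ ⟨I, _, rfl⟩
    rw [Set.mem_ofPred_eq, sum_holePt]
    have h1 : 0 ≤ ∑ j, indicator I (f j) :=
      Finset.sum_nonneg fun j _ => Set.indicator_nonneg (fun _ _ => zero_le_one) _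
    have h2 : 0 ≤ 1 / (ℓ : ℝ) := by positivity
    nlinarith [mul_nonneg h2 h1]
  · rw [Set.neg_subset]
    have : -{y : Fin d → ℝ | ∑ i, holePt ℓ f i * y i ≤ 1} =
        {y | ∑ i, (-holePt ℓ f) i * y i ≤ 1} := by
      ext y; simp
    rw [this]
    refine convexHull_min ?_ (convex_half _ _)
    rintro _ ⟨S, hS, rfl⟩
    have h1 := card_stable_le hl hG hS
    have h2 : ∑ i, (-holePt ℓ f) i * indicator S i = (∑ j, indicator S (f j)) / ℓ := by
      have := sum_holePt ℓ f (indicator S)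
      simp only [Pi.neg_apply, neg_mul, Finset.sum_neg_distrib, this]
      ring
    rw [Set.mem_ofPred_eq, h2, div_le_one hl0]
    exact h1

/-- If a finite simple graph `G` on `[d]` has an odd hole, then `Γ(O_P, Q_G)` is not
reflexive for any poset `P` on `[d]`. -/
theorem gamma_not_reflexive_of_oddHole (d : ℕ) (G : SimpleGraph (Fin d))
    (hG : HasOddHole G) (P : PartialOrder (Fin d)) :
    ¬ IsReflexive (gammaPolytope (orderPolytope P) (stableSetPolytope G)) := by
  rintro ⟨-, V, hV, hD⟩
  obtain ⟨ℓ, hl, f, hf, hadj⟩ := hG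
  have hl0 : (0 : ℝ) < ℓ := by exact_mod_cast (by omega : 0 < ℓ)
  have hmem := holePt_mem (P := P) hl hadj
  rw [hD] at hmem
  have hsub : ∀ v ∈ V, ∑ j, - v (f j) ≤ 2 := by
    intro v hv
    have h1 : v ∈ dualPolytope (gammaPolytope (orderPolytope P) (stableSetPolytope G)) := by
      rw [hD]; exact subset_convexHull ℝ _ hv
    have h2 := sum_le_of_dual hf hadj h1
    choose z hz using hV v hv
    have h3 : ∑ j, - v (f j) = ((∑ j, - z (f j) : ℤ) : ℝ) := by
      push_cast
      exact Finset.sum_congr rfl fun j _ => by rw [hz]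
    rw [h3] at h2 ⊢
    generalize (∑ j, - z (f j) : ℤ) = t at h2 ⊢
    by_contra hcon
    have h4 : (2 : ℤ) < t := by
      push Not at hcon
      exact_mod_cast hcon
    have h5 : (ℓ : ℤ) * t ≤ 2 * ℓ + 1 := by exact_mod_cast h2
    have h6 : (2 : ℤ) ≤ ℓ := by exact_mod_cast hl
    nlinarith
  have hconv : Convex ℝ {x : Fin d → ℝ | ∑ j, - x (f j) ≤ 2} := by
    apply convex_halfSpace_le
    constructor
    · intro a b
      simp [Finset.sum_add_distrib]
      ring
    · intro a b
      simp [Finset.mul_sum]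
  have hle : ∑ j, - holePt ℓ f (f j) ≤ 2 := convexHull_min (fun v hv => hsub v hv) hconv hmem
  rw [Finset.sum_congr rfl fun j _ => by rw [holePt_apply ℓ f hf j]] at hle
  simp only [neg_neg, Finset.sum_const, Finset.card_univ, ZMod.card, nsmul_eq_mul] at hle
  push_cast at hle
  rw [mul_one_div, div_le_iff₀ hl0] at hle
  linarith

end HibiTsuchiya
end

section
/- Let Δ be a simplicial complex on [d] = {1,...,d} that is not flag, i.e., Δ has a minimal nonface L with |L| ≥ 3. Then for every finite partially ordered set P on [d], the polytope Ω(O_P, P_Δ) = conv((O_P × {1}) ∪ ((−P_Δ) × {−1})) ⊂ ℝ^{d+1} does not have the integer decomposition property; in fact, writing L = {i_1,...,i_ℓ} with ℓ ≥ 3, the lattice point a = −(e_{i_1} + ... + e_{i_ℓ} + e_{d+1}) lies in 2·Ω(O_P, P_Δ) but is not a sum of two lattice points of Ω(O_P, P_Δ). -/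
open scoped Pointwise

namespace HibiTsuchiya

theorem hull_le {n : ℕ} {S : Set (Fin n → ℝ)} (f : (Fin n → ℝ) →ₗ[ℝ] ℝ) (c : ℝ)
    (h : ∀ s ∈ S, f s ≤ c) : ∀ z ∈ convexHull ℝ S, f z ≤ c := by
  have h2 : convexHull ℝ S ⊆ {w | f w ≤ c} :=
    convexHull_min h (convex_halfSpace_le f.isLinear c)
  exact fun z hz => h2 hz

theorem omega_le {n : ℕ} {A B : Set (Fin n → ℝ)} (g : (Fin n → ℝ) →ₗ[ℝ] ℝ) (α c : ℝ)
    (hA : ∀ x ∈ A, g x + α ≤ c) (hB : ∀ x ∈ B, - g x - α ≤ c)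
    (z : Fin (n + 1) → ℝ) (hz : z ∈ omegaPolytope (convexHull ℝ A) (convexHull ℝ B)) :
    g (fun i => z i.castSucc) + α * z (Fin.last n) ≤ c := by
  have key := hull_le (S := (fun x : Fin n → ℝ => (Fin.snoc x (1 : ℝ) : Fin (n + 1) → ℝ)) ''
      (convexHull ℝ A) ∪
     (fun x : Fin n → ℝ => (Fin.snoc x (-1 : ℝ) : Fin (n + 1) → ℝ)) '' (-(convexHull ℝ B)))
    (g ∘ₗ (LinearMap.funLeft ℝ ℝ (Fin.castSucc : Fin n → Fin (n + 1)))
      + α • LinearMap.proj (Fin.last n)) c ?_ z hz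
  · simpa [LinearMap.funLeft, Function.comp_def] using key
  · rintro s (⟨x, hx, rfl⟩ | ⟨x, hx, rfl⟩)
    · have := hull_le g (c - α) (fun x hx => by linarith [hA x hx]) x hx
      simp [LinearMap.funLeft, Function.comp_def]
      linarith
    · have := hull_le (-g) (c + α) (fun x hx => by
        have := hB x hx
        simp only [LinearMap.neg_apply]
        linarith) (-x) hx
      simp [LinearMap.funLeft, Function.comp_def] at this ⊢
      linarith

theorem indicator_nonneg' {n : ℕ} (S : Set (Fin n)) (i : Fin n) : 0 ≤ indicator S i := by
  unfold indicator
  exact Set.indicator_nonneg (fun _ _ => zero_le_one) i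

theorem indicator_le_one' {n : ℕ} (S : Set (Fin n)) (i : Fin n) : indicator S i ≤ 1 := by
  unfold indicator
  exact Set.indicator_le_self' (fun _ _ => zero_le_one) i

theorem omega_upper {d : ℕ} (Δ : Set (Finset (Fin d))) (P : PartialOrder (Fin d))
    (z : Fin (d + 1) → ℝ) (hz : z ∈ omegaPolytope (orderPolytope P) (complexPolytope Δ))
    (i : Fin d) : 2 * z i.castSucc ≤ 1 + z (Fin.last d) := by
  have := omega_le (LinearMap.proj i) (-1 / 2) (1 / 2) ?_ ?_ z hz
  · simp at this; linarith
  · rintro x ⟨I, -, rfl⟩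
    have := indicator_le_one' I i
    simp; linarith
  · rintro x ⟨F, -, rfl⟩
    have := indicator_nonneg' (F : Set (Fin d)) i
    simp; linarith

theorem omega_lower {d : ℕ} (Δ : Set (Finset (Fin d))) (P : PartialOrder (Fin d))
    (z : Fin (d + 1) → ℝ) (hz : z ∈ omegaPolytope (orderPolytope P) (complexPolytope Δ))
    (i : Fin d) : z (Fin.last d) - 1 ≤ 2 * z i.castSucc := by
  have := omega_le (-LinearMap.proj i) (1 / 2) (1 / 2) ?_ ?_ z hz
  · simp at this; linarith
  · rintro x ⟨I, -, rfl⟩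
    have := indicator_nonneg' I i
    simp; linarith
  · rintro x ⟨F, -, rfl⟩
    have := indicator_le_one' (F : Set (Fin d)) i
    simp; linarith

theorem omega_last {d : ℕ} (Δ : Set (Finset (Fin d))) (P : PartialOrder (Fin d))
    (z : Fin (d + 1) → ℝ) (hz : z ∈ omegaPolytope (orderPolytope P) (complexPolytope Δ)) :
    -1 ≤ z (Fin.last d) := by
  have := omega_le 0 (-1) 1 ?_ ?_ z hz
  · simp at this; linarith
  · intro x _
    norm_num
  · intro x _
    simp

theorem omega_nonface {d : ℕ} (Δ : Set (Finset (Fin d))) (hΔ : IsSimplicialComplex Δ)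
    (P : PartialOrder (Fin d)) (L : Finset (Fin d)) (hL : L ∉ Δ)
    (z : Fin (d + 1) → ℝ) (hz : z ∈ omegaPolytope (orderPolytope P) (complexPolytope Δ)) :
    - ∑ i ∈ L, z i.castSucc + ((L.card : ℝ) - 1) / 2 * z (Fin.last d)
      ≤ ((L.card : ℝ) - 1) / 2 := by
  have := omega_le (-∑ i ∈ L, LinearMap.proj i) (((L.card : ℝ) - 1) / 2)
    (((L.card : ℝ) - 1) / 2) ?_ ?_ z hz
  · simpa [LinearMap.sum_apply] using this
  · rintro x ⟨I, -, rfl⟩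
    have : 0 ≤ ∑ i ∈ L, indicator I i := Finset.sum_nonneg (fun i _ => indicator_nonneg' I i)
    simp [LinearMap.sum_apply]; linarith
  · rintro x ⟨F, hF, rfl⟩
    have hne : ¬ L ⊆ F := fun h => hL (hΔ.2 F hF L h)
    obtain ⟨j, hjL, hjF⟩ := Finset.not_subset.1 hne
    have h1 : ∑ i ∈ L, indicator (F : Set (Fin d)) i ≤ (L.card : ℝ) - 1 := by
      rw [← Finset.add_sum_erase L _ hjL]
      have h0 : indicator (F : Set (Fin d)) j = 0 := by simp [indicator, hjF]
      have h2 := Finset.sum_le_card_nsmul (L.erase j) (fun i => indicator (F : Set (Fin d)) i) 1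
        (fun i _ => indicator_le_one' _ i)
      have h3 : ((L.erase j).card : ℝ) + 1 = L.card := by
        exact_mod_cast Finset.card_erase_add_one hjL
      rw [nsmul_eq_mul, mul_one] at h2
      linarith
    simp [LinearMap.sum_apply]; linarith

theorem no_decomp_aux {d : ℕ} (Δ : Set (Finset (Fin d))) (hΔ : IsSimplicialComplex Δ)
    (P : PartialOrder (Fin d)) (L : Finset (Fin d)) (hL : L ∉ Δ)
    (a b : Fin (d + 1) → ℝ)
    (ha : a ∈ omegaPolytope (orderPolytope P) (complexPolytope Δ)) (hal : IsLatticePoint a)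
    (hb : b ∈ omegaPolytope (orderPolytope P) (complexPolytope Δ))
    (h : Fin.snoc (-(indicator (↑L : Set (Fin d)))) (-1 : ℝ) = a + b)
    (h0 : a (Fin.last d) = 0) : False := by
  have hz : ∀ i : Fin d, a i.castSucc = 0 := by
    intro i
    have h1 := omega_upper Δ P a ha i
    have h2 := omega_lower Δ P a ha i
    obtain ⟨w, hw⟩ := hal i.castSucc
    rw [h0, hw] at h1 h2
    have h1' : 2 * w ≤ 1 + 0 := by exact_mod_cast h1
    have h2' : 0 - 1 ≤ 2 * w := by exact_mod_cast h2
    have : w = 0 := by omega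
    rw [hw, this]; simp
  have hbl : b (Fin.last d) = -1 := by
    have := congrFun h (Fin.last d)
    simp [h0] at this
    linarith
  have hbi : ∀ i ∈ L, b i.castSucc = -1 := by
    intro i hi
    have := congrFun h i.castSucc
    simp [hz, indicator, hi] at this
    linarith
  have := omega_nonface Δ hΔ P L hL b hb
  rw [Finset.sum_congr rfl hbi, hbl] at this
  simp at this
  linarith

theorem no_decomp {d : ℕ} (Δ : Set (Finset (Fin d))) (hΔ : IsSimplicialComplex Δ)
    (P : PartialOrder (Fin d)) (L : Finset (Fin d)) (hL : L ∉ Δ)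
    (a b : Fin (d + 1) → ℝ)
    (ha : a ∈ omegaPolytope (orderPolytope P) (complexPolytope Δ)) (hal : IsLatticePoint a)
    (hb : b ∈ omegaPolytope (orderPolytope P) (complexPolytope Δ)) (hbl : IsLatticePoint b)
    (h : Fin.snoc (-(indicator (↑L : Set (Fin d)))) (-1 : ℝ) = a + b) : False := by
  obtain ⟨u, hu⟩ := hal (Fin.last d)
  obtain ⟨v, hv⟩ := hbl (Fin.last d)
  have hs := congrFun h (Fin.last d)
  simp [hu, hv] at hs
  have hs' : -1 = u + v := by exact_mod_cast hs
  have a3 := omega_last Δ P a ha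
  have b3 := omega_last Δ P b hb
  rw [hu] at a3
  rw [hv] at b3
  have a3' : -1 ≤ u := by exact_mod_cast a3
  have b3' : -1 ≤ v := by exact_mod_cast b3
  have huv : u = 0 ∨ v = 0 := by omega
  rcases huv with h0 | h0
  · exact no_decomp_aux Δ hΔ P L hL a b ha hal hb h (by simp [hu, h0])
  · exact no_decomp_aux Δ hΔ P L hL b a hb hbl ha (h.trans (add_comm a b)) (by simp [hv, h0])

theorem mem_two {d : ℕ} (Δ : Set (Finset (Fin d))) (hΔ : IsSimplicialComplex Δ)
    (P : PartialOrder (Fin d)) (L : Finset (Fin d)) (hcard : 3 ≤ L.card)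
    (hLmin : ∀ L' ⊂ L, L' ∈ Δ) :
    (Fin.snoc (-(indicator (↑L : Set (Fin d)))) (-1 : ℝ) ∈
      (2 : ℝ) • omegaPolytope (orderPolytope P) (complexPolytope Δ)) := by
  have hne : L.Nonempty := Finset.card_pos.1 (by omega)
  have hc : (3 : ℝ) ≤ L.card := by exact_mod_cast hcard
  have hP0 : (0 : Fin d → ℝ) ∈ orderPolytope P := by
    apply subset_convexHull
    exact ⟨∅, fun i hi => hi.elim, by simp [indicator]; rfl⟩
  have hQ0 : (0 : Fin d → ℝ) ∈ complexPolytope Δ := by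
    apply subset_convexHull
    exact ⟨∅, hLmin ∅ (Finset.empty_ssubset.2 hne), by simp [indicator]; rfl⟩
  have hconv : Convex ℝ (complexPolytope Δ) := convex_convexHull _ _
  have havg : ∑ j ∈ L, (1 / (L.card : ℝ)) • indicator ((L.erase j : Finset (Fin d)) : Set (Fin d))
      ∈ complexPolytope Δ := by
    apply hconv.sum_mem
    · intro i _; positivity
    · simp; field_simp
    · intro j hj
      exact subset_convexHull _ _ ⟨L.erase j, hLmin _ (Finset.erase_ssubset hj), rfl⟩
  have hsum : ∑ j ∈ L, (1 / (L.card : ℝ)) • indicator ((L.erase j : Finset (Fin d)) : Set (Fin d))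
      = (((L.card : ℝ) - 1) / L.card) • indicator (L : Set (Fin d)) := by
    funext i
    rw [Finset.sum_apply]
    by_cases hi : i ∈ L
    · rw [← Finset.add_sum_erase L _ hi]
      rw [Finset.sum_congr rfl (g := fun _ => 1 / (L.card : ℝ))]
      · have h3 : ((L.erase i).card : ℝ) = L.card - 1 := by
          rw [eq_sub_iff_add_eq]
          exact_mod_cast Finset.card_erase_add_one hi
        simp only [Finset.sum_const, nsmul_eq_mul, h3]
        simp [indicator, hi]
        ring
      · intro j hj
        have : i ≠ j := (Finset.ne_of_mem_erase hj).symm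
        simp [indicator, hi, this]
    · rw [Finset.sum_eq_zero]
      · simp [indicator, hi]
      · intro j _
        simp [indicator, hi]
  rw [hsum] at havg
  have h23 : (2 / 3 : ℝ) • indicator (L : Set (Fin d)) ∈ complexPolytope Δ := by
    have := hconv.smul_mem_of_zero_mem hQ0 havg
      (t := 2 * L.card / (3 * ((L.card : ℝ) - 1))) ⟨?_, ?_⟩
    · rw [smul_smul] at this
      convert this using 2
      have : (L.card : ℝ) - 1 ≠ 0 := by linarith
      field_simp
    · apply div_nonneg <;> linarith
    · rw [div_le_one (by linarith)]; linarith
  rw [Set.mem_smul_set]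
  refine ⟨(1 / 4 : ℝ) • (Fin.snoc (0 : Fin d → ℝ) (1 : ℝ) : Fin (d + 1) → ℝ) + (3 / 4 : ℝ) •
    (Fin.snoc (-((2 / 3 : ℝ) • indicator (L : Set (Fin d)))) (-1 : ℝ) : Fin (d + 1) → ℝ), ?_, ?_⟩
  · apply convex_convexHull ℝ _ _ _ (by norm_num) (by norm_num) (by norm_num)
    · exact subset_convexHull _ _ (Or.inl ⟨0, hP0, rfl⟩)
    · exact subset_convexHull _ _ (Or.inr ⟨_, by simpa using h23, rfl⟩)
  · funext i
    refine Fin.lastCases ?_ (fun i => ?_) i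
    · simp; norm_num
    · simp; ring

/-- If a simplicial complex `Δ` on `[d]` has a minimal nonface `L` with `|L| ≥ 3`, then for
every poset `P` on `[d]` the polytope `Ω(O_P, P_Δ)` does not have the integer decomposition
property; in fact `a = −(∑_{i ∈ L} e_i + e_{d+1})` lies in `2 Ω(O_P, P_Δ)` but is not a sum
of two lattice points of `Ω(O_P, P_Δ)`. -/
theorem omega_not_idp_of_not_flag (d : ℕ) (Δ : Set (Finset (Fin d)))
    (hΔ : IsSimplicialComplex Δ) (L : Finset (Fin d)) (hcard : 3 ≤ L.card)
    (hLnot : L ∉ Δ) (hLmin : ∀ L' ⊂ L, L' ∈ Δ) (P : PartialOrder (Fin d)) :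
    ¬ HasIDP (omegaPolytope (orderPolytope P) (complexPolytope Δ)) ∧
    (Fin.snoc (-(indicator (↑L : Set (Fin d)))) (-1 : ℝ) ∈
      (2 : ℝ) • omegaPolytope (orderPolytope P) (complexPolytope Δ)) ∧
    ¬ ∃ a₁ a₂ : Fin (d + 1) → ℝ,
        a₁ ∈ omegaPolytope (orderPolytope P) (complexPolytope Δ) ∧ IsLatticePoint a₁ ∧
        a₂ ∈ omegaPolytope (orderPolytope P) (complexPolytope Δ) ∧ IsLatticePoint a₂ ∧
        Fin.snoc (-(indicator (↑L : Set (Fin d)))) (-1 : ℝ) = a₁ + a₂ := by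
  have hmem := mem_two Δ hΔ P L hcard hLmin
  refine ⟨?_, hmem, ?_⟩
  · intro hI
    obtain ⟨f, hf, hsum⟩ := hI 2 (by norm_num)
      (Fin.snoc (-(indicator (↑L : Set (Fin d)))) (-1 : ℝ)) (by
      intro i
      refine Fin.lastCases ?_ (fun i => ?_) i
      · exact ⟨-1, by simp⟩
      · by_cases hi : i ∈ L
        · exact ⟨-1, by simp [indicator, hi]⟩
        · exact ⟨0, by simp [indicator, hi]⟩) (by
          rw [Nat.cast_ofNat]
          exact hmem)
    rw [Fin.sum_univ_two] at hsum
    exact no_decomp Δ hΔ P L hLnot _ _ (hf 0).1 (hf 0).2 (hf 1).1 (hf 1).2 hsum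
  · rintro ⟨a, b, ha, hal, hb, hbl, h⟩
    exact no_decomp Δ hΔ P L hLnot a b ha hal hb hbl h

end HibiTsuchiya
end
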